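/- Let k ≥ 2, s ≥ 3 and 0 ≤ r ≤ k − 1, and set n = s(k+1) + r, t = ⌈k(1+r)/(r+s)⌉, k' = k − t and n' = (s−1)(k'+1) + k'. Then t ≤ k − 1, and the pair (n', k') satisfies Trotter's subweb condition with respect to (n, k): n·k' ≤ n'·k and n'·(k+1) ≤ (k'+1)·n; hence W_{n'}^{k'} is a subweb of W_n^k. -/

import Mathlib

/-- Let `k ≥ 2`, `s ≥ 3`, `0 ≤ r ≤ k - 1`, and set `n = s(k+1) + r`,
`t = ⌈k(1+r)/(r+s)⌉`, `k' = k - t` and `n' = (s-1)(k'+1) + k'`.  Then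
`t ≤ k - 1`, and the pair `(n', k')` satisfies Trotter's subweb condition with
respect to `(n, k)`: `n·k' ≤ n'·k` and `n'·(k+1) ≤ (k'+1)·n`; hence
`W_{n'}^{k'}` is a subweb of `W_n^k`. -/
theorem trotter_condition_for_subweb (k s r n t k' n' : ℕ)
    (hk : 2 ≤ k) (hs : 3 ≤ s) (hr : r ≤ k - 1)
    (hn : n = s * (k + 1) + r)
    (ht : (t : ℤ) = ⌈(k * (1 + r) : ℚ) / ((r : ℚ) + s)⌉)
    (hk' : k' = k - t) (hn' : n' = (s - 1) * (k' + 1) + k') :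
    t ≤ k - 1 ∧ n * k' ≤ n' * k ∧ n' * (k + 1) ≤ (k' + 1) * n := by
  have hpos : (0 : ℚ) < (r : ℚ) + s := by positivity
  have hceil : k * (1 + r) ≤ t * (r + s) := by
    have h : (k * (1 + r) : ℚ) / ((r : ℚ) + s) ≤ ((t : ℤ) : ℚ) := ht ▸ Int.le_ceil _
    rw [div_le_iff₀ hpos] at h
    exact_mod_cast h
  obtain ⟨m, rfl⟩ : ∃ m, k = m + 1 := ⟨k - 1, by omega⟩
  obtain ⟨u, rfl⟩ : ∃ u, s = u + 1 := ⟨s - 1, by omega⟩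
  simp only [Nat.add_sub_cancel] at hr hn' ⊢
  have htm : t ≤ m := by
    have h : (t : ℤ) ≤ (m : ℤ) := by
      rw [ht, Int.ceil_le, div_le_iff₀ hpos]
      have h' : (m + 1) * (1 + r) ≤ m * (r + (u + 1)) := by nlinarith
      exact_mod_cast h'
    exact_mod_cast h
  obtain ⟨d, rfl⟩ := Nat.exists_eq_add_of_le htm
  obtain rfl : k' = d + 1 := by omega
  subst hn hn'
  exact ⟨htm, by nlinarith, by nlinarith⟩
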